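/- Let K be an algebraically closed field of characteristic zero, and let Λ be the Novikov field over K. Then Λ is algebraically closed: every polynomial of positive degree with coefficients in Λ has a root in Λ. -/

import Mathlib

/-- Membership in the Novikov field `Λ` over `K`: a function `f : ℝ → K`
represents a series `∑ᵢ aᵢ q^{λᵢ}` with `λᵢ → ∞` iff its support meets every
interval `(-∞, c]` in a finite set. -/
def IsNovikov {K : Type} [Field K] (f : ℝ → K) : Prop :=
  ∀ c : ℝ, {l : ℝ | f l ≠ 0 ∧ l ≤ c}.Finite

/-- The convolution product `(f·g)(λ) = ∑_{μ+ν=λ} f(μ)g(ν)`. -/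
noncomputable def novMul {K : Type} [Field K] (f g : ℝ → K) : ℝ → K :=
  fun l => ∑ᶠ m : ℝ, f m * g (l - m)

/-- The multiplicative unit `q⁰` of the Novikov field. -/
noncomputable def novOne (K : Type) [Field K] : ℝ → K := fun l => if l = 0 then 1 else 0

/-- Convolution powers: `f⁰ = q⁰`, `f^{k+1} = f·f^k`. -/
noncomputable def novPow {K : Type} [Field K] (f : ℝ → K) : ℕ → (ℝ → K)
  | 0 => novOne K
  | k + 1 => novMul f (novPow f k)

section CompleteNonarchimedean

open Polynomial

theorem Polynomial.Monic.nextCoeff_taylor {R : Type*} [CommRing R] {p : R[X]}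
    (hp : p.Monic) (hd : 0 < p.natDegree) (r : R) :
    (taylor r p).nextCoeff = p.nextCoeff + p.natDegree * r := by
  obtain ⟨m, hm⟩ : ∃ m, p.natDegree = m + 1 := ⟨p.natDegree - 1, by omega⟩
  have hlc : p.coeff (m + 1) = 1 := by rw [← hm]; exact hp
  have hdeg : (hasseDeriv m p).natDegree < 2 := by
    have := natDegree_hasseDeriv_le p m
    omega
  rw [nextCoeff_of_natDegree_pos (by simpa using hd), nextCoeff_of_natDegree_pos hd,
    natDegree_taylor, hm, Nat.add_sub_cancel, taylor_coeff, eval_eq_sum_range' hdeg]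
  simp [Finset.sum_range_succ, hasseDeriv_coeff, add_comm 1 m, hlc]

theorem norm_nextCoeff_le_spectralValue {R : Type*} [NormedRing R] {p : R[X]}
    (hd : 0 < p.natDegree) : ‖p.nextCoeff‖ ≤ spectralValue p := by
  have h := le_ciSup (spectralValueTerms_bddAbove p) (p.natDegree - 1)
  rw [spectralValueTerms_of_lt_natDegree p (by omega), Nat.cast_sub hd] at h
  rw [nextCoeff_of_natDegree_pos hd]
  simpa [spectralValue] using h

variable {K Λ : Type} [Field K] [IsAlgClosed K] [NontriviallyNormedField Λ]
  [IsUltrametricDist Λ] [CompleteSpace Λ] [Algebra K Λ]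
  {L : Type} [Field L] [Algebra Λ L] [Algebra.IsAlgebraic Λ L]

/-- If the residue field of `Λ` is an algebraically closed field of coefficients, then every
element of spectral norm at most one is congruent to a constant. -/
theorem exists_spectralMulAlgNorm_sub_const_lt_one
    (hres : ∀ x : Λ, ‖x‖ ≤ 1 → ∃ c : K, ‖x - algebraMap K Λ c‖ < 1)
    {a : L} (ha : spectralMulAlgNorm Λ L a ≤ 1) :
    ∃ c : K, spectralMulAlgNorm Λ L (a - algebraMap Λ L (algebraMap K Λ c)) < 1 := by
  set N := spectralMulAlgNorm Λ L
  have hint : IsIntegral Λ a := Algebra.IsIntegral.isIntegral a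
  set p := minpoly Λ a
  have hcoeff : ∀ i, ‖p.coeff i‖ ≤ 1 :=
    (spectralValue_le_one_iff (minpoly.monic hint)).1 ha
  choose c hc using fun i => hres (p.coeff i) (hcoeff i)
  set n := p.natDegree
  have hpos : 0 < n := minpoly.natDegree_pos hint
  set r : K[X] := ∑ i ∈ Finset.range n, C (c i) * X ^ i with hr
  have hrdeg : r.degree < n := by
    refine (degree_sum_le _ _).trans_lt ((Finset.sup_lt_iff (WithBot.bot_lt_coe n)).2 ?_)
    intro i hi
    exact (degree_C_mul_X_pow_le i (c i)).trans_lt (Nat.cast_lt.2 (Finset.mem_range.1 hi))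
  set q : K[X] := X ^ n + r with hq
  have hqm : q.Monic := monic_X_pow_add hrdeg
  have hsplit : q.Splits := IsAlgClosed.splits q
  have hNconst : ∀ x : Λ, N (algebraMap Λ L x) = ‖x‖ := spectralNorm_extends
  set φ : K →+* L := (algebraMap Λ L).comp (algebraMap K Λ) with hφ
  have hadd : ∀ x y : L, N x < 1 → N y < 1 → N (x + y) < 1 := fun x y hx hy =>
    (isNonarchimedean_spectralNorm x y).trans_lt (max_lt hx hy)
  have hqa : N (q.eval₂ φ a) < 1 := by
    have hpa : a ^ n + ∑ i ∈ Finset.range n, algebraMap Λ L (p.coeff i) * a ^ i = 0 := by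
      have h := minpoly.aeval Λ a
      rw [aeval_eq_sum_range, Finset.sum_range_succ] at h
      rw [← h]
      simp only [Algebra.smul_def]
      rw [show (minpoly Λ a).coeff (minpoly Λ a).natDegree = 1 from minpoly.monic hint]
      simp only [map_one, one_mul]
      exact add_comm _ _
    have : q.eval₂ φ a =
        ∑ i ∈ Finset.range n, -(algebraMap Λ L (p.coeff i - algebraMap K Λ (c i)) * a ^ i) := by
      rw [← sub_zero (q.eval₂ φ a), ← hpa, hq, hr]
      simp only [eval₂_add, eval₂_pow, eval₂_X, eval₂_finsetSum, eval₂_mul, eval₂_C, map_sub,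
        sub_mul, neg_sub, Finset.sum_sub_distrib, hφ, RingHom.comp_apply]
      ring
    rw [this]
    refine Finset.sum_induction _ (fun x => N x < 1) hadd (by simp) fun i _ => ?_
    rw [map_neg_eq_map, map_mul, map_pow, hNconst]
    exact mul_lt_one_of_nonneg_of_lt_one_left (norm_nonneg _) (hc i)
      (pow_le_one₀ (apply_nonneg N a) ha)
  by_contra! hall
  rw [hsplit.eq_prod_roots_of_monic hqm, eval₂_multiset_prod, map_multiset_prod,
    Multiset.map_map, Multiset.map_map] at hqa
  refine hqa.not_ge (Multiset.prod_induction (fun x : ℝ => 1 ≤ x) _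
    (fun _ _ => one_le_mul_of_one_le_of_one_le) le_rfl ?_)
  intro x hx
  obtain ⟨t, -, rfl⟩ := Multiset.mem_map.1 hx
  simpa [hφ] using hall t

/-- A complete nonarchimedean field with norm group all of `ℝ`, containing an algebraically
closed field of coefficients of characteristic zero, is algebraically closed. -/
theorem isAlgClosed_of_complete_of_residue [CharZero K]
    (hunit : ∀ c : K, c ≠ 0 → ‖algebraMap K Λ c‖ = 1)
    (hres : ∀ x : Λ, ‖x‖ ≤ 1 → ∃ c : K, ‖x - algebraMap K Λ c‖ < 1)
    (hsurj : ∀ r : ℝ, 0 < r → ∃ x : Λ, ‖x‖ = r) : IsAlgClosed Λ := by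
  have : CharZero Λ := charZero_of_injective_algebraMap (algebraMap K Λ).injective
  suffices H : ∀ a : AlgebraicClosure Λ, ∃ x : Λ, algebraMap Λ _ x = a by
    refine IsAlgClosed.of_exists_root Λ fun p _ hirr => ?_
    obtain ⟨a, ha⟩ := IsAlgClosed.exists_aeval_eq_zero (AlgebraicClosure Λ) p
      (degree_pos_of_irreducible hirr).ne'
    obtain ⟨x, rfl⟩ := H a
    rw [aeval_algebraMap_apply] at ha
    exact ⟨x, by simpa using ha⟩
  set L := AlgebraicClosure Λ
  intro a
  set N := spectralMulAlgNorm Λ L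
  have hNconst : ∀ x : Λ, N (algebraMap Λ L x) = ‖x‖ := spectralNorm_extends
  have hint : IsIntegral Λ a := Algebra.IsIntegral.isIntegral a
  set n := (minpoly Λ a).natDegree
  have hn : 0 < n := minpoly.natDegree_pos hint
  have hn0 : (n : Λ) ≠ 0 := by exact_mod_cast hn.ne'
  set t : Λ := -(minpoly Λ a).nextCoeff / n
  refine ⟨t, ?_⟩
  by_contra hne
  set b := a - algebraMap Λ L t
  have hb0 : b ≠ 0 := fun h => hne (sub_eq_zero.1 h).symm
  have hbpos : 0 < N b := (apply_nonneg N b).lt_of_ne' fun h => hb0 (N.eq_zero_of_map_eq_zero' b h)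
  obtain ⟨u, hu⟩ := hsurj _ hbpos
  have hu0 : u ≠ 0 := by rintro rfl; simp at hu; exact hbpos.ne hu
  have huL : algebraMap Λ L u ≠ 0 := by simpa using hu0
  have hscale : ∀ z, N (z / algebraMap Λ L u) * N b = N z := fun z => by
    rw [← hu, ← hNconst, ← map_mul, div_mul_cancel₀ _ huL]
  obtain ⟨c, hc⟩ := exists_spectralMulAlgNorm_sub_const_lt_one hres
    (a := b / algebraMap Λ L u)
    (le_of_mul_le_mul_right (by rw [hscale, one_mul]) hbpos)
  set s : Λ := algebraMap K Λ c * u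
  have hlt : N (b - algebraMap Λ L s) < N b := by
    rw [← hscale]
    refine mul_lt_of_lt_one_left hbpos ?_
    rwa [show (b - algebraMap Λ L s) / algebraMap Λ L u =
      b / algebraMap Λ L u - algebraMap Λ L (algebraMap K Λ c) by rw [map_mul]; field_simp]
  have hc0 : c ≠ 0 := by
    rintro rfl
    simp [s] at hlt
  have hnext : (minpoly Λ (b - algebraMap Λ L s)).nextCoeff = n * s := by
    rw [show b - algebraMap Λ L s = a - algebraMap Λ L (t + s) by
      rw [map_add]; simp only [b]; ring, minpoly.sub_algebraMap, ← taylor_apply,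
      (minpoly.monic hint).nextCoeff_taylor hn]
    simp only [t]
    field_simp
    ring
  have hle : ‖(minpoly Λ (b - algebraMap Λ L s)).nextCoeff‖ ≤ N (b - algebraMap Λ L s) :=
    norm_nextCoeff_le_spectralValue (minpoly.natDegree_pos (Algebra.IsIntegral.isIntegral _))
  have hnorm : ‖(n : Λ)‖ = 1 := by
    simpa using hunit n (by exact_mod_cast hn.ne')
  rw [hnext, norm_mul, norm_mul, hnorm, hunit c hc0, one_mul, one_mul, hu] at hle
  exact hle.not_gt hlt

end CompleteNonarchimedean

section Novikov

open HahnSeries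

variable {K : Type} [Field K]

theorem IsNovikov.isPWO {f : ℝ → K} (hf : IsNovikov f) : (Function.support f).IsPWO := by
  rw [Set.isPWO_iff_isWF, Set.isWF_iff_no_descending_seq]
  intro u hu hmem
  exact Set.infinite_range_of_injective hu.injective ((hf (u 0)).subset <| by
    rintro _ ⟨n, rfl⟩
    exact ⟨hmem n, hu.antitone n.zero_le⟩)

/-- The Hahn series with the coefficients of a Novikov series. -/
def IsNovikov.toHahnSeries {f : ℝ → K} (hf : IsNovikov f) : HahnSeries ℝ K := ⟨f, hf.isPWO⟩

open Classical in
/-- The absolute value `e ^ (-order x)` on Hahn series. -/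
noncomputable def hahnAbs (x : HahnSeries ℝ K) : ℝ := if x = 0 then 0 else Real.exp (-x.order)

theorem hahnAbs_of_ne_zero {x : HahnSeries ℝ K} (hx : x ≠ 0) :
    hahnAbs x = Real.exp (-x.order) := if_neg hx

theorem hahnAbs_le_exp_iff {x : HahnSeries ℝ K} {c : ℝ} :
    hahnAbs x ≤ Real.exp (-c) ↔ ∀ l < c, x.coeff l = 0 := by
  by_cases hx : x = 0
  · simp [hahnAbs, hx, Real.exp_nonneg]
  · rw [hahnAbs_of_ne_zero hx, Real.exp_le_exp, neg_le_neg_iff, le_order_iff_forall hx]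

theorem coeff_eq_zero_of_hahnAbs_lt {x : HahnSeries ℝ K} {c : ℝ}
    (h : hahnAbs x < Real.exp (-c)) {l : ℝ} (hl : l ≤ c) : x.coeff l = 0 := by
  by_cases hx : x = 0
  · simp [hx]
  · rw [hahnAbs_of_ne_zero hx, Real.exp_lt_exp, neg_lt_neg_iff] at h
    exact coeff_eq_zero_of_lt_order (hl.trans_lt h)

theorem hahnAbs_nonneg (x : HahnSeries ℝ K) : 0 ≤ hahnAbs x := by
  unfold hahnAbs
  split_ifs
  exacts [le_rfl, Real.exp_nonneg _]

theorem hahnAbs_eq_zero {x : HahnSeries ℝ K} : hahnAbs x = 0 ↔ x = 0 := by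
  simp [hahnAbs, Real.exp_ne_zero]

theorem hahnAbs_add_le_max (x y : HahnSeries ℝ K) :
    hahnAbs (x + y) ≤ max (hahnAbs x) (hahnAbs y) := by
  rcases (le_max_of_le_left (hahnAbs_nonneg x) : 0 ≤ max (hahnAbs x) (hahnAbs y)).eq_or_lt
    with h | h
  · have hx := hahnAbs_eq_zero.1 (le_antisymm (h ▸ le_max_left _ _) (hahnAbs_nonneg x))
    have hy := hahnAbs_eq_zero.1 (le_antisymm (h ▸ le_max_right _ _) (hahnAbs_nonneg y))
    simp [hx, hy]
  · obtain ⟨c, hc⟩ : ∃ c, max (hahnAbs x) (hahnAbs y) = Real.exp (-c) :=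
      ⟨-Real.log _, by rw [neg_neg, Real.exp_log h]⟩
    rw [hc, hahnAbs_le_exp_iff]
    intro l hl
    rw [coeff_add, hahnAbs_le_exp_iff.1 (hc ▸ le_max_left _ _) l hl,
      hahnAbs_le_exp_iff.1 (hc ▸ le_max_right _ _) l hl, add_zero]

variable (K) in
/-- `hahnAbs` as a bundled absolute value. -/
noncomputable def hahnAbsoluteValue : AbsoluteValue (HahnSeries ℝ K) ℝ where
  toFun := hahnAbs
  map_mul' x y := by
    by_cases hx : x = 0
    · simp [hx, hahnAbs]
    by_cases hy : y = 0
    · simp [hy, hahnAbs]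
    rw [hahnAbs_of_ne_zero hx, hahnAbs_of_ne_zero hy, hahnAbs_of_ne_zero (mul_ne_zero hx hy),
      order_mul hx hy, neg_add, Real.exp_add]
  nonneg' := hahnAbs_nonneg
  eq_zero' _ := hahnAbs_eq_zero
  add_le' x y := (hahnAbs_add_le_max x y).trans
    (max_le_add_of_nonneg (hahnAbs_nonneg x) (hahnAbs_nonneg y))

theorem hahnAbsoluteValue_apply (x : HahnSeries ℝ K) : hahnAbsoluteValue K x = hahnAbs x := rfl

theorem hahnAbs_single (l : ℝ) {a : K} (ha : a ≠ 0) : hahnAbs (single l a) = Real.exp (-l) := by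
  rw [hahnAbs_of_ne_zero (single_ne_zero ha), order_single ha]

theorem hahnAbs_sub_leadingTerm_lt {x : HahnSeries ℝ K} (hx : x ≠ 0) :
    hahnAbs (x - single x.order x.leadingCoeff) < hahnAbs x := by
  set y := x - single x.order x.leadingCoeff
  have hy : ∀ l ≤ x.order, y.coeff l = 0 := fun l hl => by
    rcases hl.eq_or_lt with rfl | hl
    · simp [y, leadingCoeff_eq]
    · simp [y, coeff_eq_zero_of_lt_order hl, coeff_single_of_ne hl.ne]
  by_cases h0 : y = 0
  · rw [h0, hahnAbs_eq_zero.2 rfl]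
    exact (hahnAbs_nonneg x).lt_of_ne' (mt hahnAbs_eq_zero.1 hx)
  · rw [hahnAbs_of_ne_zero h0, hahnAbs_of_ne_zero hx, Real.exp_lt_exp, neg_lt_neg_iff]
    by_contra! hle
    exact h0 (coeff_order_eq_zero.1 (hy _ hle))

theorem isNovikov_of_forall_close {x : HahnSeries ℝ K}
    (h : ∀ c : ℝ, ∃ y : HahnSeries ℝ K, IsNovikov y.coeff ∧ hahnAbs (x - y) < Real.exp (-c)) :
    IsNovikov x.coeff := by
  intro c
  obtain ⟨y, hy, hxy⟩ := h c
  refine (hy c).subset fun l hl => ⟨?_, hl.2⟩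
  have := coeff_eq_zero_of_hahnAbs_lt hxy hl.2
  rw [coeff_sub, sub_eq_zero] at this
  exact this ▸ hl.1

theorem isNovikov_single (l : ℝ) (a : K) : IsNovikov (single l a).coeff := fun c =>
  (Set.finite_singleton l).subset fun m hm => by
    by_contra hne
    exact hm.1 (coeff_single_of_ne hne)

theorem IsNovikov.coeff_add {x y : HahnSeries ℝ K} (hx : IsNovikov x.coeff)
    (hy : IsNovikov y.coeff) : IsNovikov (x + y).coeff := fun c =>
  ((hx c).union (hy c)).subset fun l hl => by
    by_contra hne
    simp only [Set.mem_union, Set.mem_ofPred_eq, hl.2, and_true, not_or, not_not] at hne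
    exact hl.1 (by rw [HahnSeries.coeff_add, hne.1, hne.2, add_zero])

theorem IsNovikov.coeff_mul {x y : HahnSeries ℝ K} (hx : IsNovikov x.coeff)
    (hy : IsNovikov y.coeff) : IsNovikov (x * y).coeff := fun c =>
  ((hx (c - y.order)).add (hy (c - x.order))).subset fun l hl => by
    obtain ⟨i, hi, j, hj, rfl⟩ := support_mul_subset ((mem_support _ _).2 hl.1)
    have h1 := order_le_of_coeff_ne_zero hi
    have h2 := order_le_of_coeff_ne_zero hj
    have h3 : i + j ≤ c := hl.2
    exact ⟨i, ⟨hi, by linarith⟩, j, ⟨hj, by linarith⟩, rfl⟩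

variable (K) in
/-- Novikov series as a subring of the Hahn series with exponents in `ℝ`. -/
def novikovSubring : Subring (HahnSeries ℝ K) where
  carrier := {x | IsNovikov x.coeff}
  mul_mem' := IsNovikov.coeff_mul
  one_mem' := isNovikov_single 0 1
  add_mem' := IsNovikov.coeff_add
  zero_mem' := by simpa using isNovikov_single (0 : ℝ) (0 : K)
  neg_mem' {x} hx := by simpa [IsNovikov] using hx

theorem isNovikov_inv_one_sub {e : HahnSeries ℝ K} (he : IsNovikov e.coeff)
    (h1 : hahnAbs e < 1) : IsNovikov (1 - e)⁻¹.coeff := by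
  have hne : 1 - e ≠ 0 := by
    intro h
    rw [← sub_eq_zero.1 h, ← hahnAbsoluteValue_apply, map_one] at h1
    exact h1.false
  have hpos : 0 < hahnAbs (1 - e)⁻¹ :=
    (hahnAbs_nonneg _).lt_of_ne' (mt hahnAbs_eq_zero.1 (inv_ne_zero hne))
  refine isNovikov_of_forall_close fun c => ?_
  obtain ⟨N, hN⟩ := exists_pow_lt_of_lt_one (div_pos (Real.exp_pos (-c)) hpos) h1
  refine ⟨∑ k ∈ Finset.range N, e ^ k,
    (novikovSubring K).sum_mem fun k _ => (novikovSubring K).pow_mem he k, ?_⟩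
  have : (1 - e)⁻¹ - ∑ k ∈ Finset.range N, e ^ k = e ^ N * (1 - e)⁻¹ := by
    rw [eq_mul_inv_iff_mul_eq₀ hne, sub_mul, inv_mul_cancel₀ hne, geom_sum_mul_neg]
    ring
  rw [this, ← hahnAbsoluteValue_apply, map_mul, map_pow]
  exact (lt_div_iff₀ hpos).1 hN

theorem IsNovikov.coeff_inv {x : HahnSeries ℝ K} (hx : IsNovikov x.coeff) :
    IsNovikov x⁻¹.coeff := by
  by_cases h0 : x = 0
  · rw [h0, inv_zero]
    exact (novikovSubring K).zero_mem
  have hlc : x.leadingCoeff ≠ 0 := leadingCoeff_ne_zero.2 h0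
  set s : HahnSeries ℝ K := single x.order x.leadingCoeff
  have hs0 : s ≠ 0 := single_ne_zero hlc
  have hsinv : s⁻¹ = single (-x.order) x.leadingCoeff⁻¹ :=
    inv_eq_of_mul_eq_one_right (by simp [s, hlc])
  have hsN : IsNovikov s⁻¹.coeff := hsinv ▸ isNovikov_single _ _
  have hxs : x⁻¹ = s⁻¹ * (1 - (1 - x * s⁻¹))⁻¹ := by
    rw [sub_sub_cancel, mul_inv, inv_inv]
    field_simp
  rw [hxs]
  refine hsN.coeff_mul (isNovikov_inv_one_sub
    ((novikovSubring K).sub_mem (novikovSubring K).one_mem (hx.coeff_mul hsN)) ?_)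
  have habs : hahnAbs s = hahnAbs x := by
    rw [hahnAbs_single _ hlc, hahnAbs_of_ne_zero h0]
  have hspos : 0 < hahnAbs s := (hahnAbs_nonneg s).lt_of_ne' (mt hahnAbs_eq_zero.1 hs0)
  have hmul : (1 - x * s⁻¹) * s = -(x - s) := by field_simp; ring
  have := hahnAbs_sub_leadingTerm_lt h0
  rw [← habs, ← hahnAbsoluteValue_apply, ← AbsoluteValue.map_neg, ← hmul, map_mul] at this
  exact (mul_lt_iff_lt_one_left hspos).1 this

variable (K) in
/-- The Novikov field, as a subfield of the Hahn series with exponents in `ℝ`. -/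
def novikovSubfield : Subfield (HahnSeries ℝ K) where
  __ := novikovSubring K
  inv_mem' _ := IsNovikov.coeff_inv

variable (K) in
/-- The Novikov field. -/
abbrev NovikovField : Type := novikovSubfield K

noncomputable instance : NormedField (NovikovField K) :=
  ((hahnAbsoluteValue K).comp (f := (novikovSubfield K).subtype)
    Subtype.val_injective).toNormedField

theorem NovikovField.norm_def (x : NovikovField K) : ‖x‖ = hahnAbs (x : HahnSeries ℝ K) := rfl

/-- The monomial `a q ^ l`. -/
noncomputable def NovikovField.monomial (l : ℝ) (a : K) : NovikovField K :=
  ⟨single l a, isNovikov_single l a⟩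

theorem NovikovField.norm_monomial (l : ℝ) {a : K} (ha : a ≠ 0) :
    ‖monomial l a‖ = Real.exp (-l) := hahnAbs_single l ha

noncomputable instance : NontriviallyNormedField (NovikovField K) where
  non_trivial := ⟨NovikovField.monomial (-1) 1, by
    rw [NovikovField.norm_monomial _ one_ne_zero, Real.one_lt_exp_iff]; norm_num⟩

instance : IsUltrametricDist (NovikovField K) :=
  IsUltrametricDist.isUltrametricDist_of_forall_norm_add_le_max_norm fun x y =>
    hahnAbs_add_le_max (x : HahnSeries ℝ K) y

instance : CompleteSpace (NovikovField K) := by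
  refine Metric.complete_of_convergent_controlled_sequences (fun N : ℕ => Real.exp (-N))
    (fun N => Real.exp_pos _) fun u hu => ?_
  have hagree : ∀ (N n : ℕ) (l : ℝ), N ≤ n → l ≤ N →
      (u n : HahnSeries ℝ K).coeff l = (u N : HahnSeries ℝ K).coeff l := fun N n l hn hl => by
    have h := hu N n N hn le_rfl
    rw [dist_eq_norm, NovikovField.norm_def] at h
    have := coeff_eq_zero_of_hahnAbs_lt h hl
    simpa [sub_eq_zero] using this
  set f : ℝ → K := fun l => (u ⌈l⌉₊ : HahnSeries ℝ K).coeff l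
  have hf : ∀ (N : ℕ) (l : ℝ), l ≤ N → f l = (u N : HahnSeries ℝ K).coeff l := fun N l hl =>
    (hagree ⌈l⌉₊ N l (Nat.ceil_le.2 hl) (Nat.le_ceil l)).symm
  have hfN : IsNovikov f := fun c =>
    ((u ⌈c⌉₊).2 c).subset fun l hl => ⟨hf ⌈c⌉₊ l (hl.2.trans (Nat.le_ceil c)) ▸ hl.1, hl.2⟩
  refine ⟨⟨hfN.toHahnSeries, hfN⟩, ?_⟩
  rw [tendsto_iff_dist_tendsto_zero]
  refine squeeze_zero (fun _ => dist_nonneg) (fun n => ?_)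
    (Real.tendsto_exp_neg_atTop_nhds_zero.comp tendsto_natCast_atTop_atTop)
  rw [dist_eq_norm, NovikovField.norm_def]
  refine hahnAbs_le_exp_iff.2 fun l hl => ?_
  have := hf n l hl.le
  simp [IsNovikov.toHahnSeries, this]

noncomputable instance : Algebra K (NovikovField K) :=
  ((HahnSeries.C : K →+* HahnSeries ℝ K).codRestrict (novikovSubfield K)
    fun a => isNovikov_single 0 a).toAlgebra

theorem NovikovField.algebraMap_eq (a : K) :
    algebraMap K (NovikovField K) a = monomial 0 a := rfl

instance [IsAlgClosed K] [CharZero K] : IsAlgClosed (NovikovField K) := by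
  refine isAlgClosed_of_complete_of_residue (K := K) (fun c hc => ?_) (fun x hx => ?_)
    fun r hr => ?_
  · rw [NovikovField.algebraMap_eq, NovikovField.norm_monomial _ hc, neg_zero, Real.exp_zero]
  · refine ⟨(x : HahnSeries ℝ K).coeff 0, ?_⟩
    by_cases h0 : (x : HahnSeries ℝ K) = 0
    · obtain rfl : x = 0 := Subtype.ext h0
      simp
    rcases hx.lt_or_eq with hlt | heq
    · have : (x : HahnSeries ℝ K).coeff 0 = 0 :=
        coeff_eq_zero_of_hahnAbs_lt (c := 0) (by simpa [NovikovField.norm_def] using hlt) le_rfl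
      simpa [this] using hlt
    · have hord : (x : HahnSeries ℝ K).order = 0 := by
        rw [NovikovField.norm_def, hahnAbs_of_ne_zero h0] at heq
        simpa using heq
      have := hahnAbs_sub_leadingTerm_lt h0
      rw [leadingCoeff_eq, hord, ← NovikovField.norm_def, heq] at this
      exact this
  · exact ⟨NovikovField.monomial (-Real.log r) 1, by
      rw [NovikovField.norm_monomial _ one_ne_zero, neg_neg, Real.exp_log hr]⟩

theorem novMul_coeff (x y : HahnSeries ℝ K) : novMul x.coeff y.coeff = (x * y).coeff := by
  funext l
  rw [HahnSeries.coeff_mul, novMul]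
  classical
  set A := Finset.antidiagonal x.isPWO_support y.isPWO_support l
  have hA : ∀ ij ∈ A, l - ij.1 = ij.2 := fun ij h => by
    rw [← (Finset.mem_antidiagonal.1 h).2.2, add_sub_cancel_left]
  rw [finsum_eq_sum_of_support_subset (s := A.image Prod.fst), Finset.sum_image]
  · exact Finset.sum_congr rfl fun ij h => by rw [hA ij h]
  · intro i hi j hj hij
    exact Prod.ext hij (by rw [← hA i hi, ← hA j hj, hij])
  · intro m hm
    refine Finset.mem_coe.2 (Finset.mem_image.2 ⟨(m, l - m), ?_, rfl⟩)
    exact Finset.mem_antidiagonal.2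
      ⟨left_ne_zero_of_mul hm, right_ne_zero_of_mul hm, add_sub_cancel m l⟩

theorem novOne_eq_coeff : novOne K = (1 : HahnSeries ℝ K).coeff := by
  funext l
  simp [novOne, HahnSeries.coeff_one]

theorem novPow_coeff (x : HahnSeries ℝ K) (k : ℕ) : novPow x.coeff k = (x ^ k).coeff := by
  induction k with
  | zero => rw [pow_zero]; exact novOne_eq_coeff
  | succ k ih => rw [novPow, ih, novMul_coeff, pow_succ']

end Novikov

/-- **The Novikov field over an algebraically closed field of characteristic
zero is algebraically closed**: every polynomial of positive degree `n` with
coefficients `c₀, …, cₙ ∈ Λ` (leading coefficient `cₙ ≠ 0`) has a root in `Λ`. -/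
theorem novikov_algebraically_closed
    (K : Type) [Field K] [IsAlgClosed K] [CharZero K] :
    ∀ n : ℕ, 1 ≤ n → ∀ c : ℕ → (ℝ → K),
      (∀ i, IsNovikov (c i)) → c n ≠ 0 →
      ∃ x : ℝ → K, IsNovikov x ∧
        ∑ i ∈ Finset.range (n + 1), novMul (c i) (novPow x i) = 0 := by
  intro n hn c hc hcn
  let d : ℕ → NovikovField K := fun i => ⟨(hc i).toHahnSeries, hc i⟩
  have hdn : d n ≠ 0 := fun h => hcn (congrArg (fun y : NovikovField K => y.1.coeff) h)
  let p : Polynomial (NovikovField K) :=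
    ∑ i ∈ Finset.range (n + 1), Polynomial.C (d i) * Polynomial.X ^ i
  have hpn : p.coeff n = d n := by simp [p, Polynomial.finsetSum_coeff, Polynomial.coeff_X_pow]
  have hdeg : p.degree ≠ 0 := fun h => by
    have := Polynomial.le_degree_of_ne_zero (hpn ▸ hdn)
    rw [h] at this
    have : n ≤ 0 := WithBot.coe_le_coe.1 this
    omega
  obtain ⟨x, hx⟩ := IsAlgClosed.exists_root p hdeg
  refine ⟨x.1.coeff, x.2, ?_⟩
  have hx' : ∑ i ∈ Finset.range (n + 1), (d i : HahnSeries ℝ K) * x.1 ^ i = 0 := by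
    have := congrArg (Subtype.val : NovikovField K → HahnSeries ℝ K) hx
    simpa [p, Polynomial.eval_finsetSum] using this
  funext l
  have h := congrArg (fun y : HahnSeries ℝ K => y.coeff l) hx'
  rw [HahnSeries.coeff_sum] at h
  rw [Finset.sum_apply]
  refine Eq.trans ?_ h
  refine Finset.sum_congr rfl fun i _ => ?_
  rw [novPow_coeff, ← novMul_coeff]
  rfl
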